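/- arXiv:2001.08727 — 2 statements merged into one kernel-verified Lean document; each statement's English description precedes it below -/
import Mathlib

section
/- For every reduced query distribution p on M ≥ 2 files, the download cost is bounded below in terms of the MaxL quantity by D(p) ≥ M / Λ(p). Equivalently, the single-server WPIR capacity under the maximal-leakage metric with normalized leakage ρ̄ = log₂ Λ(p) / log₂ M is at most 1/M^{1−ρ̄}. -/
open Finset Real

/-- A reduced query distribution on `M` files. -/
def IsRQD (M : ℕ) (p : Fin M → Finset (Fin M) → ℝ) : Prop :=
  (∀ m u, 0 ≤ p m u) ∧ (∀ m, ∑ u : Finset (Fin M), p m u = 1) ∧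
    (∀ m u, m ∉ u → p m u = 0)

/-- Download cost `D(p)`. -/
noncomputable def dlCost (M : ℕ) (p : Fin M → Finset (Fin M) → ℝ) : ℝ :=
  (1 / M) * ∑ m : Fin M, ∑ u : Finset (Fin M), p m u * u.card

/-- MaxL quantity `Λ(p) = Σ_u max_m p(u|m)`. -/
noncomputable def maxlQ (M : ℕ) (p : Fin M → Finset (Fin M) → ℝ) : ℝ :=
  ∑ u : Finset (Fin M), ⨆ m : Fin M, p m u

theorem one_le_maxlQ {M : ℕ} {p : Fin M → Finset (Fin M) → ℝ} (hp : IsRQD M p) (m : Fin M) :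
    1 ≤ maxlQ M p := by
  rw [← hp.2.1 m]
  exact Finset.sum_le_sum fun u _ => le_ciSup (f := fun m => p m u) (Set.finite_range _).bddAbove m

/-- The total weight of a query is at most its cardinality times its largest probability. -/
theorem sum_le_card_mul_iSup {M : ℕ} {p : Fin M → Finset (Fin M) → ℝ} (hp : IsRQD M p)
    (u : Finset (Fin M)) : ∑ m, p m u ≤ u.card * ⨆ m, p m u := by
  rw [← Finset.sum_subset (Finset.subset_univ u) fun m _ hm => hp.2.2 m u hm, ← nsmul_eq_mul]
  exact Finset.sum_le_card_nsmul _ _ _ fun m _ =>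
    le_ciSup (f := fun m => p m u) (Set.finite_range _).bddAbove m

theorem sq_le_sum_mul_maxlQ {M : ℕ} {p : Fin M → Finset (Fin M) → ℝ} (hp : IsRQD M p) :
    (M : ℝ) ^ 2 ≤ (∑ m, ∑ u : Finset (Fin M), p m u * u.card) * maxlQ M p := by
  have hM : (M : ℝ) = ∑ u : Finset (Fin M), ∑ m, p m u := by
    rw [Finset.sum_comm]
    simp [hp.2.1]
  have hS (u : Finset (Fin M)) : 0 ≤ ∑ m, p m u := Finset.sum_nonneg fun m _ => hp.1 m u
  rw [hM, Finset.sum_comm (f := fun m u => p m u * (u.card : ℝ))]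
  simp_rw [← Finset.sum_mul]
  refine Finset.sum_sq_le_sum_mul_sum_of_sq_le_mul _ (fun u _ => mul_nonneg (hS u) (by positivity))
    (fun u _ => Real.iSup_nonneg fun m => hp.1 m u) fun u _ => ?_
  rw [sq, mul_assoc]
  exact mul_le_mul_of_nonneg_left (sum_le_card_mul_iSup hp u) (hS u)

/-- For every reduced query distribution, `D(p) ≥ M / Λ(p)`; i.e., the
single-server WPIR capacity under maximal leakage is at most `1/M^(1−ρ̄)`. -/
theorem stmt3 (M : ℕ) (hM : 2 ≤ M) (p : Fin M → Finset (Fin M) → ℝ)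
    (hp : IsRQD M p) :
    (M : ℝ) / maxlQ M p ≤ dlCost M p := by
  have hM' : (0 : ℝ) < M := by exact_mod_cast (by omega : 0 < M)
  have hL : 0 < maxlQ M p := one_pos.trans_le (one_le_maxlQ hp ⟨0, by omega⟩)
  rw [dlCost, div_le_iff₀ hL, mul_assoc, one_div, le_inv_mul_iff₀ hM', ← sq]
  exact sq_le_sum_mul_maxlQ hp
end

section
/- Fix an integer M ≥ 2 and define, for t ∈ [1, M], the function G(t) as the infimum of the download cost D(p) over all reduced query distributions p with MaxL quantity Λ(p) ≤ t. Then G is convex: for all t₁, t₂ ∈ [1, M] and λ ∈ [0,1], G((1−λ)t₁ + λt₂) ≤ (1−λ)G(t₁) + λG(t₂). (Equivalently, the MaxL download-leakage function D^MaxL(log₂ t) is convex in t, although D^MaxL(ρ) itself is not convex in ρ.) -/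
open Finset Real

/-- `G(t)`: infimum of the download cost over reduced query distributions with
MaxL quantity `Λ(p)` at most `t` (so `G(2^ρ)` is the MaxL download-leakage function). -/
noncomputable def GMaxL (M : ℕ) (t : ℝ) : ℝ :=
  sInf {d : ℝ | ∃ p : Fin M → Finset (Fin M) → ℝ,
    IsRQD M p ∧ maxlQ M p ≤ t ∧ dlCost M p = d}

theorem dlCost_nonneg (M : ℕ) (p : Fin M → Finset (Fin M) → ℝ) (hp : IsRQD M p) :
    0 ≤ dlCost M p :=
  mul_nonneg (by positivity) (Finset.sum_nonneg fun m _ =>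
    Finset.sum_nonneg fun u _ => mul_nonneg (hp.1 m u) (Nat.cast_nonneg _))

theorem bddBelow_dlCost (M : ℕ) (t : ℝ) :
    BddBelow {d : ℝ | ∃ p : Fin M → Finset (Fin M) → ℝ,
      IsRQD M p ∧ maxlQ M p ≤ t ∧ dlCost M p = d} := by
  refine ⟨0, ?_⟩
  rintro _ ⟨p, hp, -, rfl⟩
  exact dlCost_nonneg M p hp

/-- Always downloading the sum of all files leaks nothing. -/
theorem nonempty_dlCost {M : ℕ} (hM : 0 < M) {t : ℝ} (ht : 1 ≤ t) :
    {d : ℝ | ∃ p : Fin M → Finset (Fin M) → ℝ,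
      IsRQD M p ∧ maxlQ M p ≤ t ∧ dlCost M p = d}.Nonempty := by
  have : Nonempty (Fin M) := ⟨⟨0, hM⟩⟩
  refine ⟨_, fun _ u => if u = Finset.univ then 1 else 0, ⟨fun m u => ?_, fun m => ?_,
    fun m u hu => ?_⟩, ?_, rfl⟩
  · positivity
  · simp
  · exact if_neg fun h : u = Finset.univ => hu (h ▸ Finset.mem_univ m)
  · simpa [maxlQ] using ht

theorem IsRQD.convexComb {M : ℕ} {p q : Fin M → Finset (Fin M) → ℝ} (hp : IsRQD M p)
    (hq : IsRQD M q) {a b : ℝ} (ha : 0 ≤ a) (hb : 0 ≤ b) (hab : a + b = 1) :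
    IsRQD M (fun m u => a * p m u + b * q m u) := by
  refine ⟨fun m u => add_nonneg (mul_nonneg ha (hp.1 m u)) (mul_nonneg hb (hq.1 m u)),
    fun m => ?_, fun m u hu => ?_⟩
  · rw [Finset.sum_add_distrib, ← Finset.mul_sum, ← Finset.mul_sum, hp.2.1, hq.2.1, mul_one,
      mul_one, hab]
  · simp [hp.2.2 m u hu, hq.2.2 m u hu]

theorem dlCost_convexComb (M : ℕ) (p q : Fin M → Finset (Fin M) → ℝ) (a b : ℝ) :
    dlCost M (fun m u => a * p m u + b * q m u) = a * dlCost M p + b * dlCost M q := by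
  simp only [dlCost, add_mul, Finset.sum_add_distrib, mul_assoc, ← Finset.mul_sum]
  ring

theorem maxlQ_convexComb_le {M : ℕ} (hM : 0 < M) (p q : Fin M → Finset (Fin M) → ℝ) {a b : ℝ}
    (ha : 0 ≤ a) (hb : 0 ≤ b) :
    maxlQ M (fun m u => a * p m u + b * q m u) ≤ a * maxlQ M p + b * maxlQ M q := by
  have : Nonempty (Fin M) := ⟨⟨0, hM⟩⟩
  simp only [maxlQ, Finset.mul_sum, ← Finset.sum_add_distrib]
  refine Finset.sum_le_sum fun u _ => ciSup_le fun m => ?_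
  gcongr
  · exact le_ciSup (f := fun m => p m u) (Set.finite_range _).bddAbove m
  · exact le_ciSup (f := fun m => q m u) (Set.finite_range _).bddAbove m

/-- `G` is convex on `[1, M]`, i.e. `D^MaxL(log₂ t)` is convex in `t`. -/
theorem stmt8 (M : ℕ) (hM : 2 ≤ M) (t₁ t₂ lam : ℝ)
    (ht₁0 : 1 ≤ t₁) (ht₁1 : t₁ ≤ (M : ℝ))
    (ht₂0 : 1 ≤ t₂) (ht₂1 : t₂ ≤ (M : ℝ))
    (hl0 : 0 ≤ lam) (hl1 : lam ≤ 1) :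
    GMaxL M ((1 - lam) * t₁ + lam * t₂)
      ≤ (1 - lam) * GMaxL M t₁ + lam * GMaxL M t₂ := by
  have hM0 : 0 < M := by omega
  refine le_of_forall_pos_le_add fun ε hε => ?_
  obtain ⟨_, ⟨p, hp, hpt, rfl⟩, hpε⟩ :=
    Real.lt_sInf_add_pos (nonempty_dlCost hM0 ht₁0) hε
  obtain ⟨_, ⟨q, hq, hqt, rfl⟩, hqε⟩ :=
    Real.lt_sInf_add_pos (nonempty_dlCost hM0 ht₂0) hε
  have hl : 0 ≤ 1 - lam := sub_nonneg.2 hl1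
  calc GMaxL M ((1 - lam) * t₁ + lam * t₂)
      ≤ (1 - lam) * dlCost M p + lam * dlCost M q := by
        refine csInf_le (bddBelow_dlCost M _) ⟨_, hp.convexComb hq hl hl0 (by ring), ?_,
          dlCost_convexComb M p q _ _⟩
        exact (maxlQ_convexComb_le hM0 p q hl hl0).trans (by gcongr)
    _ ≤ (1 - lam) * (GMaxL M t₁ + ε) + lam * (GMaxL M t₂ + ε) :=
        add_le_add (mul_le_mul_of_nonneg_left hpε.le hl) (mul_le_mul_of_nonneg_left hqε.le hl0)
    _ = (1 - lam) * GMaxL M t₁ + lam * GMaxL M t₂ + ε := by ring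
end
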